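/- arXiv:2405.15904 — 2 statements merged into one kernel-verified Lean document; each statement's English description precedes it below -/
import Mathlib

section
/- For all n ≥ 4, in every edge-coloring of K_n in which each path on 4 vertices receives at least 3 distinct colors, all edges receive distinct colors; hence f(K_n, P_4, 3) = C(n,2). -/
open Finset

/-- The number of colors used by an edge-coloring `c` of `K_n`. -/
def usedColors (n : ℕ) (c : Sym2 (Fin n) → ℕ) : ℕ :=
  (((Finset.univ : Finset (Sym2 (Fin n))).filter fun e => ¬ e.IsDiag).image c).card

/-- `v` lists `k` distinct vertices: it is injective on `{0, …, k-1}`. -/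
def InjOnFirst (n k : ℕ) (v : ℕ → Fin n) : Prop :=
  ∀ i j, i < k → j < k → v i = v j → i = j

/-- The number of distinct colors on the path `v 0 — v 1 — ⋯ — v (k-1)` on `k` vertices. -/
def pathColorCount (n k : ℕ) (c : Sym2 (Fin n) → ℕ) (v : ℕ → Fin n) : ℕ :=
  ((Finset.range (k - 1)).image fun i => c s(v i, v (i + 1))).card

/-- If every path on four vertices is rainbow, then so is the path `a — b — x — y`. -/
lemma path_colors_ne {n : ℕ} {c : Sym2 (Fin n) → ℕ}
    (h : ∀ v : ℕ → Fin n, InjOnFirst n 4 v → 3 ≤ pathColorCount n 4 c v)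
    {a b x y : Fin n} (hab : a ≠ b) (hax : a ≠ x) (hay : a ≠ y) (hbx : b ≠ x) (hby : b ≠ y)
    (hxy : x ≠ y) : c s(a, b) ≠ c s(b, x) ∧ c s(a, b) ≠ c s(x, y) := by
  have key := h (fun i => if i = 0 then a else if i = 1 then b else if i = 2 then x else y) (by
    intro i j hi hj hij
    interval_cases i <;> interval_cases j <;> simp_all)
  have himage : pathColorCount n 4 c
      (fun i => if i = 0 then a else if i = 1 then b else if i = 2 then x else y) =
      ({c s(a, b), c s(b, x), c s(x, y)} : Finset ℕ).card := by
    unfold pathColorCount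
    congr 1
    ext k
    simp [Finset.range_add_one]
    tauto
  rw [himage] at key
  constructor
  · intro heq
    rw [heq, Finset.insert_eq_of_mem (by simp)] at key
    have := Finset.card_le_two (a := c s(b, x)) (b := c s(x, y))
    omega
  · intro heq
    rw [heq, Finset.insert_eq_of_mem (by simp)] at key
    have := Finset.card_le_two (a := c s(b, x)) (b := c s(x, y))
    omega

/-- Adjacent edges receive distinct colors if every path on four vertices is rainbow. -/
lemma adjacent_colors_ne {n : ℕ} (hn : 4 ≤ n) {c : Sym2 (Fin n) → ℕ}
    (h : ∀ v : ℕ → Fin n, InjOnFirst n 4 v → 3 ≤ pathColorCount n 4 c v)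
    {a b x : Fin n} (hab : a ≠ b) (hax : a ≠ x) (hbx : b ≠ x) :
    c s(a, b) ≠ c s(b, x) := by
  obtain ⟨y, hy⟩ : ∃ y, y ∉ ({a, b, x} : Finset (Fin n)) := by
    by_contra! hall
    have hcard := Finset.card_le_three (a := a) (b := b) (c := x)
    rw [Finset.eq_univ_of_forall hall, Finset.card_univ, Fintype.card_fin] at hcard
    omega
  simp only [Finset.mem_insert, Finset.mem_singleton, not_or] at hy
  exact (path_colors_ne h hab hax (Ne.symm hy.1) hbx (Ne.symm hy.2.1) (Ne.symm hy.2.2)).1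

/-- For `n ≥ 4`, in every edge-coloring of `K_n` in which every path on
4 vertices receives at least 3 distinct colors, all edges receive distinct colors; hence
exactly `C(n,2)` colors are used, so `f(K_n, P_4, 3) = C(n,2)`. -/
theorem generalized_ramsey_P4 (n : ℕ) (hn : 4 ≤ n) (c : Sym2 (Fin n) → ℕ)
    (h : ∀ v : ℕ → Fin n, InjOnFirst n 4 v → 3 ≤ pathColorCount n 4 c v) :
    (∀ e f : Sym2 (Fin n), ¬ e.IsDiag → ¬ f.IsDiag → e ≠ f → c e ≠ c f) ∧
    usedColors n c = n.choose 2 := by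
  have hinj : ∀ e f : Sym2 (Fin n), ¬ e.IsDiag → ¬ f.IsDiag → e ≠ f → c e ≠ c f := by
    intro e f
    induction e using Sym2.ind with | _ a b
    induction f using Sym2.ind with | _ x y
    intro hab hxy hne
    rw [Sym2.mk_isDiag_iff] at hab hxy
    by_cases hbx : b = x
    · subst hbx
      exact adjacent_colors_ne hn h hab (by rintro rfl; exact hne Sym2.eq_swap) hxy
    by_cases hby : b = y
    · subst hby
      rw [Sym2.eq_swap (a := x)]
      exact adjacent_colors_ne hn h hab (by rintro rfl; exact hne rfl) hbx
    by_cases hax : a = x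
    · subst hax
      rw [Sym2.eq_swap (a := a) (b := b)]
      exact adjacent_colors_ne hn h (Ne.symm hab) hby hxy
    by_cases hay : a = y
    · subst hay
      rw [Sym2.eq_swap (a := a) (b := b), Sym2.eq_swap (a := x)]
      exact adjacent_colors_ne hn h (Ne.symm hab) hbx hax
    exact (path_colors_ne h hab hax hay hbx hby hxy).2
  refine ⟨hinj, ?_⟩
  rw [usedColors, Finset.card_image_of_injOn, ← Fintype.card_subtype,
    Sym2.card_subtype_not_diag, Fintype.card_fin]
  intro e he f hf hef
  by_contra hne
  exact hinj e f (by simpa using he) (by simpa using hf) hne hef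
end

section
/- For all n ≥ 5, in every edge-coloring of K_n in which each path on 5 vertices receives at least 4 distinct colors, all edges receive distinct colors; hence f(K_n, P_5, 4) = C(n,2). -/
open Finset

/-- A finite set of fewer than `n` vertices misses some vertex of `Fin n`. -/
theorem exists_notMem_of_card_lt {n : ℕ} (s : Finset (Fin n)) (hs : s.card < n) :
    ∃ x, x ∉ s := by
  by_contra! hx
  have hcard := Finset.card_eq_of_equiv_fin
    (Equiv.subtypeUnivEquiv hx : {x // x ∈ s} ≃ Fin n)
  omega

/-- A path on `k` vertices receiving at least `k - 1` colors is rainbow. -/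
theorem injOn_of_le_pathColorCount {n k : ℕ} {c : Sym2 (Fin n) → ℕ} {v : ℕ → Fin n}
    (h : k - 1 ≤ pathColorCount n k c v) :
    Set.InjOn (fun i => c s(v i, v (i + 1))) (Finset.range (k - 1)) := by
  refine Finset.card_image_iff.mp (le_antisymm Finset.card_image_le ?_)
  simpa [pathColorCount] using h

/-- If every path on 5 vertices is rainbow, then on a path `a, b, x, d, e` the first edge differs
in color from the second and the third. -/
theorem color_ne_of_path {n : ℕ} {c : Sym2 (Fin n) → ℕ}
    (h : ∀ v : ℕ → Fin n, InjOnFirst n 5 v → 4 ≤ pathColorCount n 5 c v)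
    {a b x d e : Fin n} (hnodup : [a, b, x, d, e].Nodup) :
    c s(a, b) ≠ c s(b, x) ∧ c s(a, b) ≠ c s(x, d) := by
  let v : ℕ → Fin n := fun i => [a, b, x, d, e].getD i a
  have hv : InjOnFirst n 5 v := by
    intro i j hi hj hij
    simp only [v] at hij
    rw [List.getD_eq_getElem _ _ (by simpa using hi),
      List.getD_eq_getElem _ _ (by simpa using hj)] at hij
    exact (hnodup.getElem_inj_iff).mp hij
  have hinj := injOn_of_le_pathColorCount (k := 5) (h v hv)
  refine ⟨fun heq => ?_, fun heq => ?_⟩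
  · have := @hinj 0 (by simp) 1 (by simp) heq
    omega
  · have := @hinj 0 (by simp) 2 (by simp) heq
    omega

/-- Two edges sharing a vertex get distinct colors. -/
theorem color_ne_of_adjacent {n : ℕ} (hn : 5 ≤ n) {c : Sym2 (Fin n) → ℕ}
    (h : ∀ v : ℕ → Fin n, InjOnFirst n 5 v → 4 ≤ pathColorCount n 5 c v)
    {a b x : Fin n} (hab : a ≠ b) (hbx : b ≠ x) (hax : a ≠ x) :
    c s(a, b) ≠ c s(b, x) := by
  obtain ⟨d, hd⟩ := exists_notMem_of_card_lt {a, b, x} (Finset.card_le_three.trans_lt (by omega))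
  obtain ⟨e, he⟩ :=
    exists_notMem_of_card_lt {a, b, x, d} (Finset.card_le_four.trans_lt (by omega))
  exact (color_ne_of_path h (a := a) (b := b) (x := x) (d := d) (e := e) (by grind)).1

/-- Two disjoint edges get distinct colors. -/
theorem color_ne_of_disjoint {n : ℕ} (hn : 5 ≤ n) {c : Sym2 (Fin n) → ℕ}
    (h : ∀ v : ℕ → Fin n, InjOnFirst n 5 v → 4 ≤ pathColorCount n 5 c v)
    {a b x d : Fin n} (hnodup : [a, b, x, d].Nodup) :
    c s(a, b) ≠ c s(x, d) := by
  obtain ⟨e, he⟩ :=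
    exists_notMem_of_card_lt {a, b, x, d} (Finset.card_le_four.trans_lt (by omega))
  exact (color_ne_of_path h (a := a) (b := b) (x := x) (d := d) (e := e) (by grind)).2

/-- For `n ≥ 5`, in every edge-coloring of `K_n` in which every path on
5 vertices receives at least 4 distinct colors, all edges receive distinct colors; hence
exactly `C(n,2)` colors are used, so `f(K_n, P_5, 4) = C(n,2)`. -/
theorem generalized_ramsey_P5 (n : ℕ) (hn : 5 ≤ n) (c : Sym2 (Fin n) → ℕ)
    (h : ∀ v : ℕ → Fin n, InjOnFirst n 5 v → 4 ≤ pathColorCount n 5 c v) :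
    (∀ e f : Sym2 (Fin n), ¬ e.IsDiag → ¬ f.IsDiag → e ≠ f → c e ≠ c f) ∧
    usedColors n c = n.choose 2 := by
  have hne : ∀ e f : Sym2 (Fin n), ¬ e.IsDiag → ¬ f.IsDiag → e ≠ f → c e ≠ c f := by
    intro e f
    induction e using Sym2.ind with | _ a b
    induction f using Sym2.ind with | _ x y
    intro hab hxy hef
    rw [Sym2.mk_isDiag_iff] at hab hxy
    by_cases hax : a = x
    · subst hax
      rw [Sym2.eq_swap]
      exact color_ne_of_adjacent hn h (by grind) hxy (by grind)
    by_cases hay : a = y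
    · subst hay
      rw [Sym2.eq_swap, Sym2.eq_swap (a := x)]
      exact color_ne_of_adjacent hn h (by grind) (by grind) (by grind)
    by_cases hbx : b = x
    · subst hbx
      exact color_ne_of_adjacent hn h hab hxy hay
    by_cases hby : b = y
    · subst hby
      rw [Sym2.eq_swap (a := x)]
      exact color_ne_of_adjacent hn h hab (by grind) hax
    exact color_ne_of_disjoint hn h (by grind)
  refine ⟨hne, ?_⟩
  rw [usedColors, Finset.card_image_of_injOn, ← Fintype.card_subtype,
    Sym2.card_subtype_not_diag, Fintype.card_fin]
  intro e he f hf hef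
  by_contra hdistinct
  exact hne e f (by simpa using he) (by simpa using hf) hdistinct hef
end
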